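/- Let Δ, Δ' be standard sets of the same cardinality with Δ ≤ Δ' in the dominance order and Δ ≠ Δ'. Then ∑_{(a,b)∈Δ} a < ∑_{(a,b)∈Δ'} a and ∑_{(a,b)∈Δ} b > ∑_{(a,b)∈Δ'} b: the sum of first coordinates is strictly smaller for the dominance-smaller set, and the sum of second coordinates is strictly larger. -/

import Mathlib

/-- A standard set (staircase) in `ℕ²`: a finite, downward closed set. -/
def IsStandardSet (Δ : Finset (ℕ × ℕ)) : Prop :=
  ∀ p ∈ Δ, ∀ q : ℕ × ℕ, q.1 ≤ p.1 → q.2 ≤ p.2 → q ∈ Δ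

/-- The dominance (natural) partial order on standard sets of equal cardinality. -/
def DomLE (Δ Δ' : Finset (ℕ × ℕ)) : Prop :=
  (∀ i : ℕ, (Δ.filter (fun p => p.2 < i)).card ≤ (Δ'.filter (fun p => p.2 < i)).card) ∧
  (∀ j : ℕ, (Δ'.filter (fun p => p.1 < j)).card ≤ (Δ.filter (fun p => p.1 < j)).card)

theorem sum_add_counts (S : Finset (ℕ × ℕ)) (f : ℕ × ℕ → ℕ) (N : ℕ) (hN : ∀ p ∈ S, f p ≤ N) :
    ∑ p ∈ S, f p + ∑ i ∈ Finset.range N, (S.filter (fun p => f p < i + 1)).card = S.card * N := by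
  simp only [Finset.card_filter]
  rw [Finset.sum_comm, ← Finset.sum_add_distrib, Finset.sum_const_nat]
  intro p hp
  have h := hN p hp
  rw [← Finset.card_filter]
  have : (Finset.range N).filter (fun i => f p < i + 1) = Finset.Ico (f p) N := by
    ext i; simp only [Finset.mem_filter, Finset.mem_range, Finset.mem_Ico]; omega
  rw [this, Nat.card_Ico]; omega

theorem eq_of_counts (S T : Finset (ℕ × ℕ)) (f g : ℕ × ℕ → ℕ)
    (hS : ∀ p ∈ S, ∀ q, f q ≤ f p → g q ≤ g p → q ∈ S)
    (hT : ∀ p ∈ T, ∀ q, f q ≤ f p → g q ≤ g p → q ∈ T)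
    (hc : S.card = T.card)
    (h : ∀ b, (S.filter (fun p => g p = b)).card = (T.filter (fun p => g p = b)).card) :
    S = T := by
  apply Finset.eq_of_subset_of_card_le _ hc.ge
  intro p hp
  by_contra hpT
  have : T.filter (fun q => g q = g p) ⊂ S.filter (fun q => g q = g p) := by
    rw [Finset.ssubset_iff_of_subset]
    · exact ⟨p, by simp [hp], by simp [hpT]⟩
    · intro q hq
      rw [Finset.mem_filter] at hq ⊢
      refine ⟨hS p hp q ?_ hq.2.le, hq.2⟩
      by_contra hlt
      exact hpT (hT q hq.1 p (by omega) hq.2.ge)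
  have h2 := Finset.card_lt_card this
  have h3 := h (g p)
  omega

theorem sum_lt_of_counts (S T : Finset (ℕ × ℕ)) (f g : ℕ × ℕ → ℕ)
    (hS : ∀ p ∈ S, ∀ q, f q ≤ f p → g q ≤ g p → q ∈ S)
    (hT : ∀ p ∈ T, ∀ q, f q ≤ f p → g q ≤ g p → q ∈ T)
    (hc : S.card = T.card) (hne : S ≠ T)
    (h : ∀ i, (S.filter (fun p => g p < i)).card ≤ (T.filter (fun p => g p < i)).card) :
    ∑ p ∈ T, g p < ∑ p ∈ S, g p := by
  have key : ∃ i, (S.filter (fun p => g p < i + 1)).card < (T.filter (fun p => g p < i + 1)).card := by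
    by_contra hcon
    push Not at hcon
    apply hne
    apply eq_of_counts S T f g hS hT hc
    have heq : ∀ i, (S.filter (fun p => g p < i)).card = (T.filter (fun p => g p < i)).card := by
      intro i
      cases i with
      | zero => simp
      | succ i => exact le_antisymm (h _) (hcon i)
    have split : ∀ (U : Finset (ℕ × ℕ)) (b : ℕ), (U.filter (fun p => g p < b + 1)).card
        = (U.filter (fun p => g p < b)).card + (U.filter (fun p => g p = b)).card := by
      intro U b
      rw [← Finset.card_union_of_disjoint]
      · congr 1
        ext p
        simp only [Finset.mem_filter, Finset.mem_union, Nat.lt_succ_iff_lt_or_eq]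
        tauto
      · rw [Finset.disjoint_filter]
        intro p _ h1 h2
        omega
    intro b
    have h1 := split S b
    have h2 := split T b
    have h3 := heq b
    have h4 := heq (b + 1)
    omega
  obtain ⟨i, hi⟩ := key
  set N := (S ∪ T).sup g + i + 1 with hN
  have hb : ∀ p ∈ S ∪ T, g p ≤ N := fun p hp => by
    have := Finset.le_sup (f := g) hp
    omega
  have e1 := sum_add_counts S g N (fun p hp => hb p (Finset.mem_union_left _ hp))
  have e2 := sum_add_counts T g N (fun p hp => hb p (Finset.mem_union_right _ hp))
  have hlt := Finset.sum_lt_sum (s := Finset.range N) (fun j _ => h (j + 1))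
    ⟨i, Finset.mem_range.2 (by omega), hi⟩
  rw [hc] at e1
  omega

/-- If `Δ < Δ'` in the dominance order (standard sets of the same cardinality), then the
sum of first coordinates of `Δ` is strictly smaller and the sum of second coordinates
is strictly larger. -/
theorem coordinate_sums_of_dominance_lt
    (Δ Δ' : Finset (ℕ × ℕ)) (hΔ : IsStandardSet Δ) (hΔ' : IsStandardSet Δ')
    (hcard : Δ.card = Δ'.card) (hdom : DomLE Δ Δ') (hne : Δ ≠ Δ') :
    (∑ p ∈ Δ, p.1) < (∑ p ∈ Δ', p.1) ∧ (∑ p ∈ Δ', p.2) < (∑ p ∈ Δ, p.2) := by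
  exact ⟨sum_lt_of_counts Δ' Δ Prod.snd Prod.fst (fun p hp q h1 h2 => hΔ' p hp q h2 h1)
      (fun p hp q h1 h2 => hΔ p hp q h2 h1) hcard.symm hne.symm hdom.2,
    sum_lt_of_counts Δ Δ' Prod.fst Prod.snd hΔ hΔ' hcard hne hdom.1⟩
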